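/- arXiv:2605.13620 — 3 statements merged into one kernel-verified Lean document; each statement's English description precedes it below -/
import Mathlib

section
/- Let Θ ⊂ ℝᵖ be a nonempty compact convex set, let U be an open neighborhood of Θ, and let F : U → ℝ be continuously differentiable. Let G : Θ × Θ → ℝ be a family of surrogate functions such that, for each anchor θ' ∈ Θ: (i) G(θ | θ') ≥ F(θ) for all θ ∈ Θ (majorization); (ii) G(θ' | θ') = F(θ') and ∇₁G(θ' | θ') = ∇F(θ') (strong tangency); and (iii) the partial gradient ∇₁G(· | θ') is L-Lipschitz continuous on Θ, with the same constant L > 0 for all θ'. Let {ε_t}_{t≥0} be strictly positive numbers with Σ_{t=0}^∞ ε_t < ∞, and let {θ̂_t}_{t≥0} ⊂ Θ be a sequence such that for every t, G(θ̂_{t+1} | θ̂_t) ≤ inf_{θ ∈ Θ} G(θ | θ̂_t) + ε_t. Then every accumulation point θ* of the sequence {θ̂_t} is a first-order stationary point of F over Θ, i.e., ⟨∇F(θ*), θ − θ*⟩ ≥ 0 for all θ ∈ Θ. -/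
open Filter
open scoped RealInnerProductSpace Topology

/-- First-order upper bound for a function whose gradient is Lipschitz at `x` on a convex set. -/
lemma le_add_inner_gradient_add_mul_sq {E : Type*} [NormedAddCommGroup E] [InnerProductSpace ℝ E]
    [CompleteSpace E] {s : Set E} (hs : Convex ℝ s) {f : E → ℝ} {L : ℝ} (hL : 0 ≤ L)
    (hf : ∀ z ∈ s, DifferentiableAt ℝ f z) {x y : E} (hx : x ∈ s) (hy : y ∈ s)
    (hLip : ∀ z ∈ s, ‖gradient f z - gradient f x‖ ≤ L * ‖z - x‖) :
    f y ≤ f x + ⟪gradient f x, y - x⟫ + L * ‖y - x‖ ^ 2 := by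
  have hseg : segment ℝ x y ⊆ s := hs.segment_subset hx hy
  have key := (convex_segment (𝕜 := ℝ) x y).norm_image_sub_le_of_norm_hasFDerivWithin_le'
    (f := f) (f' := fun z => InnerProductSpace.toDual ℝ E (gradient f z))
    (φ := InnerProductSpace.toDual ℝ E (gradient f x)) (C := L * ‖y - x‖)
    (fun z hz => (hf z (hseg hz)).hasGradientAt.hasFDerivAt.hasFDerivWithinAt)
    (fun z hz => by
      rw [← map_sub, LinearIsometryEquiv.norm_map]
      refine (hLip z (hseg hz)).trans (mul_le_mul_of_nonneg_left ?_ hL)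
      obtain ⟨t, ht, rfl⟩ := (segment_eq_image' ℝ x y).subset hz
      rw [add_sub_cancel_left, norm_smul, Real.norm_of_nonneg ht.1]
      exact mul_le_of_le_one_left (norm_nonneg _) ht.2)
    (left_mem_segment ℝ x y) (right_mem_segment ℝ x y)
  rw [InnerProductSpace.toDual_apply_apply, Real.norm_eq_abs] at key
  linarith [le_abs_self (f y - f x - ⟪gradient f x, y - x⟫)]

/-- A sequence bounded below that increases by at most a summable error converges. -/
lemma exists_tendsto_of_le_add_summable {a ε : ℕ → ℝ} (ha : BddBelow (Set.range a))
    (hε : Summable ε) (hε0 : ∀ n, 0 ≤ ε n) (h : ∀ n, a (n + 1) ≤ a n + ε n) :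
    ∃ l, Tendsto a atTop (𝓝 l) := by
  have hanti : Antitone fun n => a n - ∑ i ∈ Finset.range n, ε i :=
    antitone_nat_of_succ_le fun n => by
      rw [Finset.sum_range_succ]
      linarith [h n]
  obtain ⟨m, hm⟩ := ha
  have hbdd : BddBelow (Set.range fun n => a n - ∑ i ∈ Finset.range n, ε i) := by
    refine ⟨m - ∑' i, ε i, ?_⟩
    rintro _ ⟨n, rfl⟩
    exact sub_le_sub (hm ⟨n, rfl⟩) (hε.sum_le_tsum _ fun i _ => hε0 i)
  have hlim := (tendsto_atTop_ciInf hanti hbdd).add hε.hasSum.tendsto_sum_nat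
  simp only [sub_add_cancel] at hlim
  exact ⟨_, hlim⟩

/-- The gradient of a `C^1` function on an open set is continuous there. -/
lemma ContDiffOn.continuousOn_gradient {E : Type*} [NormedAddCommGroup E] [InnerProductSpace ℝ E]
    [CompleteSpace E] {f : E → ℝ} {U : Set E} (hf : ContDiffOn ℝ 1 f U) (hU : IsOpen U) :
    ContinuousOn (gradient f) U :=
  (InnerProductSpace.toDual ℝ E).symm.continuous.comp_continuousOn
    (hf.continuousOn_fderiv_of_isOpen hU le_rfl)

/-- convergence of inexact majorization-minimization.  If `Θ ⊂ ℝᵖ` is a nonempty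
compact convex set, `F` is continuously differentiable on an open neighborhood `U` of `Θ`,
`G(· | θ')` is a family of differentiable surrogates satisfying majorization, strong tangency
and a uniform `L`-Lipschitz gradient condition, the tolerances `ε_t > 0` are summable, and
`θ̂_{t+1}` is an `ε_t`-approximate minimizer of `G(· | θ̂_t)` over `Θ`, then every accumulation
point `θ*` of `{θ̂_t}` is a first-order stationary point of `F` over `Θ`:
`⟨∇F(θ*), θ − θ*⟩ ≥ 0` for all `θ ∈ Θ`.  Here `G θ θ'` denotes `G(θ | θ')`. -/
theorem stmt5 {p : ℕ} (Θ U : Set (EuclideanSpace ℝ (Fin p)))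
    (hne : Θ.Nonempty) (hcomp : IsCompact Θ) (hconv : Convex ℝ Θ)
    (hUopen : IsOpen U) (hΘU : Θ ⊆ U)
    (F : EuclideanSpace ℝ (Fin p) → ℝ) (hF : ContDiffOn ℝ 1 F U)
    (G : EuclideanSpace ℝ (Fin p) → EuclideanSpace ℝ (Fin p) → ℝ)
    (L : ℝ) (hL : 0 < L)
    (hGdiff : ∀ θ' ∈ Θ, ∀ θ ∈ Θ, DifferentiableAt ℝ (fun t => G t θ') θ)
    (hmaj : ∀ θ' ∈ Θ, ∀ θ ∈ Θ, F θ ≤ G θ θ')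
    (htan : ∀ θ' ∈ Θ, G θ' θ' = F θ')
    (hgradtan : ∀ θ' ∈ Θ, gradient (fun t => G t θ') θ' = gradient F θ')
    (hGLip : ∀ θ' ∈ Θ, ∀ θ₁ ∈ Θ, ∀ θ₂ ∈ Θ,
      ‖gradient (fun t => G t θ') θ₁ - gradient (fun t => G t θ') θ₂‖ ≤ L * ‖θ₁ - θ₂‖)
    (ε : ℕ → ℝ) (hεpos : ∀ t, 0 < ε t) (hεsum : Summable ε)
    (θh : ℕ → EuclideanSpace ℝ (Fin p)) (hθh : ∀ t, θh t ∈ Θ)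
    (hstep : ∀ t, ∀ θ ∈ Θ, G (θh (t + 1)) (θh t) ≤ G θ (θh t) + ε t)
    (θstar : EuclideanSpace ℝ (Fin p))
    (hacc : ∃ φ : ℕ → ℕ, StrictMono φ ∧ Tendsto (θh ∘ φ) atTop (𝓝 θstar)) :
    ∀ θ ∈ Θ, 0 ≤ ⟪gradient F θstar, θ - θstar⟫ := by
  obtain ⟨φ, hφ, hlim⟩ := hacc
  have hstar : θstar ∈ Θ := hcomp.isClosed.mem_of_tendsto hlim (.of_forall fun n => hθh _)
  intro θ hθ
  have hdescent : ∀ t, ∀ s ∈ Set.Icc (0 : ℝ) 1, F (θh (t + 1)) ≤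
      F (θh t) + s * ⟪gradient F (θh t), θ - θh t⟫ + L * s ^ 2 * ‖θ - θh t‖ ^ 2 + ε t := by
    intro t s hs
    have hx := hθh t
    have hy : θh t + s • (θ - θh t) ∈ Θ := hconv.add_smul_sub_mem hx hθ hs
    have hbound := le_add_inner_gradient_add_mul_sq hconv hL.le (hGdiff _ hx) hx hy
      fun z hz => hGLip _ hx z hz _ hx
    rw [hgradtan _ hx, htan _ hx, add_sub_cancel_left, inner_smul_right, norm_smul, mul_pow,
      Real.norm_eq_abs, sq_abs] at hbound
    linarith [hmaj _ hx _ (hθh (t + 1)), hstep t _ hy]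
  obtain ⟨l, hl⟩ : ∃ l, Tendsto (fun t => F (θh t)) atTop (𝓝 l) := by
    refine exists_tendsto_of_le_add_summable ?_ hεsum (fun t => (hεpos t).le) fun t => ?_
    · refine (hcomp.bddBelow_image (hF.continuousOn.mono hΘU)).mono ?_
      rintro _ ⟨t, rfl⟩
      exact ⟨_, hθh t, rfl⟩
    · simpa using hdescent t 0 (by simp)
  have hgrad : Tendsto (fun n => gradient F (θh (φ n))) atTop (𝓝 (gradient F θstar)) :=
    ((hF.continuousOn_gradient hUopen).continuousAt (hUopen.mem_nhds (hΘU hstar))).tendsto.comp hlim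
  have hdiff : Tendsto (fun n => θ - θh (φ n)) atTop (𝓝 (θ - θstar)) :=
    tendsto_const_nhds.sub hlim
  have hquad : ∀ s ∈ Set.Icc (0 : ℝ) 1,
      0 ≤ s * ⟪gradient F θstar, θ - θstar⟫ + L * s ^ 2 * ‖θ - θstar‖ ^ 2 := by
    intro s hs
    have hlhs := hl.comp ((tendsto_add_atTop_nat 1).comp hφ.tendsto_atTop)
    have hrhs := (((hl.comp hφ.tendsto_atTop).add ((hgrad.inner hdiff).const_mul s)).add
      ((hdiff.norm.pow 2).const_mul (L * s ^ 2))).add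
        (hεsum.tendsto_atTop_zero.comp hφ.tendsto_atTop)
    linarith [le_of_tendsto_of_tendsto' hlhs hrhs fun n => hdescent (φ n) s hs]
  have hcont : Tendsto (fun s : ℝ => ⟪gradient F θstar, θ - θstar⟫ + L * s * ‖θ - θstar‖ ^ 2)
      (𝓝[>] 0) (𝓝 ⟪gradient F θstar, θ - θstar⟫) := by
    refine tendsto_nhdsWithin_of_tendsto_nhds (Continuous.tendsto' (by fun_prop) _ _ (by simp))
  refine ge_of_tendsto hcont ?_
  filter_upwards [Ioc_mem_nhdsGT (zero_lt_one (α := ℝ))] with s hs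
  refine nonneg_of_mul_nonneg_right ?_ hs.1
  linarith [hquad s ⟨hs.1.le, hs.2⟩]
end

section
/- Let Θ ⊂ ℝᵖ be a nonempty convex set, let U be an open neighborhood of Θ, and let F : U → ℝ be continuously differentiable. Let θ̂ ∈ Θ be an anchor point and let G(· | θ̂) : Θ → ℝ satisfy: G(θ | θ̂) ≥ F(θ) for all θ ∈ Θ; G(θ̂ | θ̂) = F(θ̂); ∇₁G(θ̂ | θ̂) = ∇F(θ̂); and ∇₁G(· | θ̂) is L-Lipschitz on Θ. Suppose θ⁺ ∈ Θ satisfies G(θ⁺ | θ̂) ≤ inf_{θ ∈ Θ} G(θ | θ̂) + ε for some ε ≥ 0. Then for every θ ∈ Θ, F(θ⁺) − F(θ̂) ≤ ⟨∇F(θ̂), θ − θ̂⟩ + (L/2) ‖θ − θ̂‖₂² + ε. -/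
open scoped RealInnerProductSpace

/-- The quadratic upper bound for a function with `L`-Lipschitz gradient on a convex set. -/
theorem le_quadratic_of_lipschitz_gradient {E : Type*} [NormedAddCommGroup E]
    [InnerProductSpace ℝ E] [CompleteSpace E] {s : Set E} (hs : Convex ℝ s) {g : E → ℝ} {L : ℝ}
    (hg : ∀ x ∈ s, DifferentiableAt ℝ g x)
    (hLip : ∀ x ∈ s, ∀ y ∈ s, ‖gradient g x - gradient g y‖ ≤ L * ‖x - y‖)
    {x y : E} (hx : x ∈ s) (hy : y ∈ s) :
    g y ≤ g x + ⟪gradient g x, y - x⟫ + L / 2 * ‖y - x‖ ^ 2 := by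
  set v := y - x
  have hmem : ∀ t ∈ Set.Icc (0 : ℝ) 1, x + t • v ∈ s := fun t ht =>
    hs.add_smul_sub_mem hx hy ht
  have hderiv : ∀ t ∈ Set.Icc (0 : ℝ) 1,
      HasDerivAt (fun t : ℝ => g (x + t • v) - t * ⟪gradient g x, v⟫ - L / 2 * ‖v‖ ^ 2 * t ^ 2)
        (⟪gradient g (x + t • v) - gradient g x, v⟫ - L * ‖v‖ ^ 2 * t) t := by
    intro t ht
    have hline : HasDerivAt (fun t : ℝ => x + t • v) v t := by
      simpa using ((hasDerivAt_id t).smul_const v).const_add x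
    have hcomp := (hg _ (hmem t ht)).hasGradientAt.hasFDerivAt.comp_hasDerivAt t hline
    refine ((hcomp.sub ((hasDerivAt_id t).mul_const ⟪gradient g x, v⟫)).sub
      ((hasDerivAt_pow 2 t).const_mul (L / 2 * ‖v‖ ^ 2))).congr_deriv ?_
    simp only [InnerProductSpace.toDual_apply_apply, inner_sub_left]
    norm_num
    ring
  have hanti : AntitoneOn
      (fun t : ℝ => g (x + t • v) - t * ⟪gradient g x, v⟫ - L / 2 * ‖v‖ ^ 2 * t ^ 2)
      (Set.Icc 0 1) := by
    refine antitoneOn_of_hasDerivWithinAt_nonpos (convex_Icc 0 1)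
      (fun t ht => (hderiv t ht).continuousAt.continuousWithinAt)
      (fun t ht => (hderiv t (interior_subset ht)).hasDerivWithinAt) fun t ht => ?_
    have ht' := interior_subset ht
    have hbound := hLip _ (hmem t ht') x hx
    rw [add_sub_cancel_left, norm_smul, Real.norm_of_nonneg ht'.1] at hbound
    have hinner := real_inner_le_norm (gradient g (x + t • v) - gradient g x) v
    have hmul := mul_le_mul_of_nonneg_right hbound (norm_nonneg v)
    linarith
  have hle := hanti (Set.left_mem_Icc.2 zero_le_one) (Set.right_mem_Icc.2 zero_le_one) zero_le_one
  have hxy : x + v = y := add_sub_cancel x y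
  simp only [one_smul, zero_smul, add_zero, hxy] at hle
  linarith

/-- one-step inexact majorization-minimization descent bound.  Let `Θ ⊂ ℝᵖ` be
nonempty convex, `F` continuously differentiable on an open neighborhood `U` of `Θ`, and let
`G` be a differentiable surrogate anchored at `θ̂ ∈ Θ` satisfying majorization, tangency in
value and gradient, and `L`-Lipschitz continuity of its gradient on `Θ`.  If `θ⁺ ∈ Θ` is an
`ε`-approximate minimizer of `G` over `Θ` then for every `θ ∈ Θ`,
`F(θ⁺) − F(θ̂) ≤ ⟨∇F(θ̂), θ − θ̂⟩ + (L/2)‖θ − θ̂‖² + ε`. -/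
theorem stmt6 {p : ℕ} (Θ U : Set (EuclideanSpace ℝ (Fin p)))
    (hne : Θ.Nonempty) (hconv : Convex ℝ Θ)
    (hUopen : IsOpen U) (hΘU : Θ ⊆ U)
    (F : EuclideanSpace ℝ (Fin p) → ℝ) (hF : ContDiffOn ℝ 1 F U)
    (θhat : EuclideanSpace ℝ (Fin p)) (hθhat : θhat ∈ Θ)
    (G : EuclideanSpace ℝ (Fin p) → ℝ)
    (L : ℝ) (hL : 0 < L)
    (hGdiff : ∀ θ ∈ Θ, DifferentiableAt ℝ G θ)
    (hmaj : ∀ θ ∈ Θ, F θ ≤ G θ)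
    (htan : G θhat = F θhat)
    (hgradtan : gradient G θhat = gradient F θhat)
    (hGLip : ∀ θ₁ ∈ Θ, ∀ θ₂ ∈ Θ, ‖gradient G θ₁ - gradient G θ₂‖ ≤ L * ‖θ₁ - θ₂‖)
    (ε : ℝ) (hε : 0 ≤ ε)
    (θplus : EuclideanSpace ℝ (Fin p)) (hθplus : θplus ∈ Θ)
    (hmin : ∀ θ ∈ Θ, G θplus ≤ G θ + ε) :
    ∀ θ ∈ Θ, F θplus - F θhat ≤ ⟪gradient F θhat, θ - θhat⟫ + (L / 2) * ‖θ - θhat‖ ^ 2 + ε := by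
  intro θ hθ
  have hquad := le_quadratic_of_lipschitz_gradient hconv hGdiff hGLip hθhat hθ
  rw [hgradtan, htan] at hquad
  linarith [hmaj θplus hθplus, hmin θ hθ]
end

section
/- Let B be a real symmetric m×m matrix and let w₁, …, w_N be independent Rademacher vectors in ℝᵐ. Then the variance of the Hutchinson estimator (1/N) Σ_{i=1}^N w_iᵀ B w_i equals (2/N) ‖B̄‖_F², where B̄ = B − diag(B) is the off-diagonal part of B. Equivalently, for a single Rademacher vector w, Var(wᵀ B w) = 2 Σ_{i≠j} B_{ij}² = 2 ‖B̄‖_F². -/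
open Matrix MeasureTheory

/-- The Rademacher distribution on `ℝ`: `+1` and `−1` each with probability `1/2`. -/
noncomputable def rademacher : Measure ℝ :=
  (2 : ENNReal)⁻¹ • Measure.dirac (1 : ℝ) + (2 : ENNReal)⁻¹ • Measure.dirac (-1 : ℝ)

/-- The squared Frobenius norm `‖A‖_F² = Σ_{i,j} A_{ij}²` of a real matrix. -/
def frobSq {m : ℕ} (A : Matrix (Fin m) (Fin m) ℝ) : ℝ := ∑ i, ∑ j, (A i j) ^ 2

instance : IsProbabilityMeasure rademacher :=
  ⟨by simp [rademacher, ENNReal.inv_two_add_inv_two]⟩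

lemma integrable_rademacher (f : ℝ → ℝ) : Integrable f rademacher := by
  refine Integrable.add_measure ?_ ?_ <;>
    exact (integrable_dirac (by simp)).smul_measure (by simp)

lemma integral_rademacher (f : ℝ → ℝ) : ∫ x, f x ∂rademacher = (f 1 + f (-1)) / 2 := by
  rw [rademacher, integral_add_measure
    ((integrable_dirac (by simp)).smul_measure (by simp))
    ((integrable_dirac (by simp)).smul_measure (by simp))]
  simp
  ring

lemma ae_sq_eq_one_rademacher : ∀ᵐ x ∂rademacher, x ^ 2 = 1 := by
  refine ae_add_measure_iff.2 ⟨Measure.ae_smul_measure ?_ _, Measure.ae_smul_measure ?_ _⟩ <;>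
    simp [ae_dirac_eq]

section Moments

variable {ι : Type*} [Fintype ι]

lemma ae_sq_eq_one_pi_rademacher :
    ∀ᵐ x ∂Measure.pi (fun _ : ι => rademacher), ∀ i, x i ^ 2 = 1 :=
  ae_all_iff.2 fun i =>
    (measurePreserving_eval (fun _ : ι => rademacher) i).quasiMeasurePreserving.ae
      ae_sq_eq_one_rademacher

lemma integrable_prod_pow_rademacher (a : ι → ℕ) :
    Integrable (fun x : ι → ℝ => ∏ t, x t ^ a t) (Measure.pi fun _ => rademacher) :=
  Integrable.fintype_prod (f := fun t y => y ^ a t) fun _ => integrable_rademacher _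

lemma integral_prod_pow_rademacher (a : ι → ℕ) :
    ∫ x : ι → ℝ, ∏ t, x t ^ a t ∂(Measure.pi fun _ => rademacher) =
      if ∀ t, Even (a t) then 1 else 0 := by
  rw [integral_fintype_prod_eq_prod (fun t y => y ^ a t)]
  simp only [integral_rademacher, one_pow]
  split_ifs with h
  · exact Finset.prod_eq_one fun t _ => by rw [(h t).neg_one_pow]; norm_num
  · push Not at h
    obtain ⟨t, ht⟩ := h
    refine Finset.prod_eq_zero (Finset.mem_univ t) ?_
    rw [(Nat.not_even_iff_odd.1 ht).neg_one_pow]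
    norm_num

variable [DecidableEq ι]

lemma eval_mul_eval_eq_prod_pow (x : ι → ℝ) (i j : ι) :
    x i * x j = ∏ t, x t ^ ((if t = i then 1 else 0) + if t = j then 1 else 0) := by
  simp only [pow_add, Finset.prod_mul_distrib, pow_ite, pow_one, pow_zero, Finset.prod_ite_eq',
    Finset.mem_univ, if_true]

lemma integrable_eval_mul_eval (i j : ι) :
    Integrable (fun x : ι → ℝ => x i * x j) (Measure.pi fun _ => rademacher) := by
  simp only [eval_mul_eval_eq_prod_pow]
  exact integrable_prod_pow_rademacher _

lemma integral_eval_mul_eval {i j : ι} (hij : i ≠ j) :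
    ∫ x : ι → ℝ, x i * x j ∂(Measure.pi fun _ => rademacher) = 0 := by
  simp only [eval_mul_eval_eq_prod_pow]
  rw [integral_prod_pow_rademacher, if_neg]
  intro h
  simpa [hij] using h i

lemma eval_mul_eval_mul_eq_prod_pow (x : ι → ℝ) (i j k l : ι) :
    x i * x j * (x k * x l) = ∏ t, x t ^ (((if t = i then 1 else 0) + if t = j then 1 else 0) +
      ((if t = k then 1 else 0) + if t = l then 1 else 0)) := by
  simp only [eval_mul_eval_eq_prod_pow, ← Finset.prod_mul_distrib, ← pow_add]

lemma integrable_eval_mul_eval_mul (i j k l : ι) :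
    Integrable (fun x : ι → ℝ => x i * x j * (x k * x l)) (Measure.pi fun _ => rademacher) := by
  simp only [eval_mul_eval_mul_eq_prod_pow]
  exact integrable_prod_pow_rademacher _

lemma integral_eval_mul_eval_mul {i j k l : ι} (hij : i ≠ j) (hkl : k ≠ l) :
    ∫ x : ι → ℝ, x i * x j * (x k * x l) ∂(Measure.pi fun _ => rademacher) =
      (if i = k ∧ j = l then 1 else 0) + if i = l ∧ j = k then 1 else 0 := by
  simp only [eval_mul_eval_mul_eq_prod_pow]
  rw [integral_prod_pow_rademacher]
  by_cases h₁ : i = k ∧ j = l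
  · obtain ⟨rfl, rfl⟩ := h₁
    simp [hij]
  by_cases h₂ : i = l ∧ j = k
  · obtain ⟨rfl, rfl⟩ := h₂
    rw [if_pos fun t => by rw [add_comm (if t = j then 1 else 0)]; simp]
    simp [hij]
  rw [if_neg h₁, if_neg h₂, add_zero, if_neg]
  intro h
  have hi := h i
  have hj := h j
  grind

end Moments

section QuadraticForm

open ProbabilityTheory

variable {m : ℕ}

lemma dotProduct_mulVec_eq_sum (A : Matrix (Fin m) (Fin m) ℝ) (x : Fin m → ℝ) :
    x ⬝ᵥ (A *ᵥ x) = ∑ i, ∑ j, A i j * (x i * x j) := by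
  simp only [dotProduct, mulVec, Finset.mul_sum]
  exact Finset.sum_congr rfl fun i _ => Finset.sum_congr rfl fun j _ => by ring

@[fun_prop]
lemma measurable_dotProduct_mulVec (A : Matrix (Fin m) (Fin m) ℝ) :
    Measurable fun x : Fin m → ℝ => x ⬝ᵥ (A *ᵥ x) := by
  simp only [dotProduct_mulVec_eq_sum]
  fun_prop

lemma dotProduct_mulVec_sq_eq_sum (A : Matrix (Fin m) (Fin m) ℝ) (x : Fin m → ℝ) :
    (x ⬝ᵥ (A *ᵥ x)) ^ 2 =
      ∑ i, ∑ j, ∑ k, ∑ l, A i j * A k l * (x i * x j * (x k * x l)) := by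
  rw [sq, dotProduct_mulVec_eq_sum]
  simp only [Finset.sum_mul]
  simp only [Finset.mul_sum]
  refine Finset.sum_congr rfl fun i _ => Finset.sum_congr rfl fun j _ =>
    Finset.sum_congr rfl fun k _ => Finset.sum_congr rfl fun l _ => by ring

lemma memLp_dotProduct_mulVec (A : Matrix (Fin m) (Fin m) ℝ) :
    MemLp (fun x : Fin m → ℝ => x ⬝ᵥ (A *ᵥ x)) 2 (Measure.pi fun _ => rademacher) := by
  rw [memLp_two_iff_integrable_sq (by fun_prop)]
  simp only [dotProduct_mulVec_sq_eq_sum]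
  exact integrable_finsetSum _ fun i _ => integrable_finsetSum _ fun j _ =>
    integrable_finsetSum _ fun k _ => integrable_finsetSum _ fun l _ =>
      (integrable_eval_mul_eval_mul i j k l).const_mul _

lemma integral_dotProduct_mulVec_of_diag_eq_zero {A : Matrix (Fin m) (Fin m) ℝ}
    (hA : ∀ i, A i i = 0) :
    ∫ x : Fin m → ℝ, x ⬝ᵥ (A *ᵥ x) ∂(Measure.pi fun _ => rademacher) = 0 := by
  have hint (i j : Fin m) := (integrable_eval_mul_eval i j).const_mul (A i j)
  simp only [dotProduct_mulVec_eq_sum]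
  rw [integral_finsetSum _ fun i _ => integrable_finsetSum _ fun j _ => hint i j]
  refine Finset.sum_eq_zero fun i _ => ?_
  rw [integral_finsetSum _ fun j _ => hint i j]
  refine Finset.sum_eq_zero fun j _ => ?_
  rw [integral_const_mul]
  rcases eq_or_ne i j with rfl | hij
  · simp [hA]
  · simp [integral_eval_mul_eval hij]

lemma integral_dotProduct_mulVec_sq {A : Matrix (Fin m) (Fin m) ℝ}
    (hA : ∀ i, A i i = 0) (hs : A.IsSymm) :
    ∫ x : Fin m → ℝ, (x ⬝ᵥ (A *ᵥ x)) ^ 2 ∂(Measure.pi fun _ => rademacher) = 2 * frobSq A := by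
  have hint (i j k l : Fin m) := (integrable_eval_mul_eval_mul i j k l).const_mul (A i j * A k l)
  simp only [dotProduct_mulVec_sq_eq_sum]
  rw [integral_finsetSum _ fun i _ => integrable_finsetSum _ fun j _ =>
    integrable_finsetSum _ fun k _ => integrable_finsetSum _ fun l _ => hint i j k l]
  rw [frobSq, Finset.mul_sum]
  refine Finset.sum_congr rfl fun i _ => ?_
  rw [integral_finsetSum _ fun j _ => integrable_finsetSum _ fun k _ =>
    integrable_finsetSum _ fun l _ => hint i j k l, Finset.mul_sum]
  refine Finset.sum_congr rfl fun j _ => ?_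
  have hterm (k l : Fin m) :
      ∫ x : Fin m → ℝ, A i j * A k l * (x i * x j * (x k * x l)) ∂(Measure.pi fun _ => rademacher)
        = (if i = k then if j = l then A i j * A k l else 0 else 0) +
          if j = k then if i = l then A i j * A k l else 0 else 0 := by
    rw [integral_const_mul]
    rcases eq_or_ne i j with rfl | hij
    · simp [hA]
    rcases eq_or_ne k l with rfl | hkl
    · simp [hA]
    rw [integral_eval_mul_eval_mul hij hkl]
    simp only [ite_and, mul_add, mul_ite, mul_one, mul_zero]
    congr 1
    split_ifs <;> rfl
  rw [integral_finsetSum _ fun k _ => integrable_finsetSum _ fun l _ => hint i j k l]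
  simp_rw [integral_finsetSum _ fun l _ => hint i j _ l, hterm, Finset.sum_add_distrib]
  simp [hs.apply i j]
  ring

lemma variance_dotProduct_mulVec {B : Matrix (Fin m) (Fin m) ℝ} (hB : B.IsSymm) :
    variance (fun x : Fin m → ℝ => x ⬝ᵥ (B *ᵥ x)) (Measure.pi fun _ => rademacher) =
      2 * frobSq (B - Matrix.diagonal fun i => B i i) := by
  set A := B - Matrix.diagonal fun i => B i i with hAdef
  have hA (i : Fin m) : A i i = 0 := by simp [hAdef]
  have hs : A.IsSymm := hB.sub (Matrix.isSymm_diagonal _)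
  have hae : (fun x : Fin m → ℝ => x ⬝ᵥ (B *ᵥ x)) =ᵐ[Measure.pi fun _ => rademacher]
      fun x => x ⬝ᵥ (A *ᵥ x) + ∑ i, B i i := by
    filter_upwards [ae_sq_eq_one_pi_rademacher] with x hx
    rw [hAdef, sub_mulVec, dotProduct_sub, sub_add, eq_comm, sub_eq_self, sub_eq_zero]
    simp only [dotProduct, mulVec_diagonal]
    exact Finset.sum_congr rfl fun i _ => by linear_combination B i i * hx i
  rw [variance_congr hae, variance_add_const (by fun_prop),
    variance_of_integral_eq_zero (by fun_prop) (integral_dotProduct_mulVec_of_diag_eq_zero hA),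
    integral_dotProduct_mulVec_sq hA hs]

end QuadraticForm

/-- variance of the Hutchinson estimator.  If `B` is a real symmetric `m × m`
matrix and `w₁, …, w_N` are independent Rademacher vectors (i.e. the joint law of the `N`
vectors is the product of `N` copies of the product of `m` Rademacher distributions), then
`Var((1/N) Σᵢ wᵢᵀ B wᵢ) = (2/N) ‖B̄‖_F²`, where `B̄ = B − diag(B)`; equivalently, for a single
Rademacher vector `v`, `Var(vᵀ B v) = 2 ‖B̄‖_F²`. -/
theorem stmt15 {m N : ℕ} (hN : 1 ≤ N) (B : Matrix (Fin m) (Fin m) ℝ) (hB : B.IsSymm)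
    {Ω : Type*} [MeasurableSpace Ω] (μ : Measure Ω) [IsProbabilityMeasure μ]
    (w : Ω → Fin N → Fin m → ℝ) (hw : Measurable w)
    (hdist : μ.map w = Measure.pi (fun _ : Fin N => Measure.pi (fun _ : Fin m => rademacher))) :
    ProbabilityTheory.variance
        (fun ω => (1 / (N : ℝ)) * ∑ i, (w ω i) ⬝ᵥ (B *ᵥ w ω i)) μ =
      (2 / (N : ℝ)) * frobSq (B - Matrix.diagonal (fun i => B i i)) ∧
    ∀ v : Ω → Fin m → ℝ, Measurable v →
      μ.map v = Measure.pi (fun _ : Fin m => rademacher) →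
      ProbabilityTheory.variance (fun ω => (v ω) ⬝ᵥ (B *ᵥ v ω)) μ =
        2 * frobSq (B - Matrix.diagonal (fun i => B i i)) := by
  have hN' : (N : ℝ) ≠ 0 := by positivity
  constructor
  · have key := ProbabilityTheory.variance_sum_pi
      (μ := fun _ : Fin N => Measure.pi fun _ : Fin m => rademacher)
      (X := fun _ x => x ⬝ᵥ (B *ᵥ x)) fun _ => memLp_dotProduct_mulVec B
    have hmeas : Measurable (∑ i : Fin N, fun x : Fin N → Fin m → ℝ => x i ⬝ᵥ (B *ᵥ x i)) := by
      rw [Finset.sum_fn]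
      exact Finset.measurable_fun_sum _ fun i _ =>
        (measurable_dotProduct_mulVec B).comp (measurable_pi_apply i)
    rw [← hdist, ProbabilityTheory.variance_map hmeas.aemeasurable hw.aemeasurable] at key
    have hcomp : (∑ i : Fin N, fun x : Fin N → Fin m → ℝ => x i ⬝ᵥ (B *ᵥ x i)) ∘ w =
        fun ω => ∑ i, w ω i ⬝ᵥ (B *ᵥ w ω i) := by
      ext ω
      simp
    rw [hcomp] at key
    rw [ProbabilityTheory.variance_const_mul, key]
    simp only [variance_dotProduct_mulVec hB, Finset.sum_const, Finset.card_univ,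
      Fintype.card_fin, nsmul_eq_mul]
    field_simp
  · intro v hv hvdist
    rw [← variance_dotProduct_mulVec hB, ← hvdist,
      ProbabilityTheory.variance_map (by fun_prop) hv.aemeasurable]
    rfl
end
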